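/- Let R be a commutative ring, let y₁, …, y_r ∈ R be a regular sequence (each yᵢ is a nonzerodivisor on R/(y₁, …, y_{i−1})) generating a proper ideal I = (y₁, …, y_r), and let ε : R → ℤ be a ring homomorphism, so that ℤ is an R-module via ε. Assume ε(yᵢ) > 0 for all i, and set x = gcd(ε(y₁), …, ε(y_r)). Then for every natural number k with 0 ≤ k ≤ r − 1, Tor_k^R(R/I, ℤ) is isomorphic to the direct sum of binom(r−1, k) copies of ℤ/xℤ, and Tor_k^R(R/I, ℤ) = 0 for every k ≥ r. -/

import Mathlib

open CategoryTheory

theorem ZMod.exists_surjective_ker_eq_range_zsmul (n : ℕ) (a : ℤ) :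
    ∃ q : ZMod n →+ ZMod (Int.gcd n a), Function.Surjective q ∧
      ∀ t, q t = 0 ↔ ∃ s, a • s = t := by
  have hg : Int.gcd n a ∣ n := by exact_mod_cast Int.gcd_dvd_left (n : ℤ) a
  refine ⟨(ZMod.castHom hg (ZMod (Int.gcd n a))).toAddMonoidHom,
    ZMod.castHom_surjective hg, fun t => ?_⟩
  obtain ⟨t, rfl⟩ := ZMod.intCast_surjective t
  constructor
  · intro h
    have h' : ((t : ℤ) : ZMod (Int.gcd n a)) = 0 := by simpa using h
    obtain ⟨m, rfl⟩ := (ZMod.intCast_zmod_eq_zero_iff_dvd _ _).1 h'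
    refine ⟨((Int.gcdB n a * m : ℤ) : ZMod n), ?_⟩
    rw [Int.gcd_eq_gcd_ab]
    push_cast
    simp
    ring
  · rintro ⟨s, hs⟩
    rw [← hs, map_zsmul, zsmul_eq_mul,
      (ZMod.intCast_zmod_eq_zero_iff_dvd a (Int.gcd n a)).2 (Int.gcd_dvd_right _ _), zero_mul]

theorem ZMod.exists_injective_range_eq_ker_zsmul {n : ℕ} (hn : 0 < n) (a : ℤ) :
    ∃ j : ZMod (Int.gcd n a) →+ ZMod n, Function.Injective j ∧
      ∀ t, a • t = 0 ↔ ∃ s, j s = t := by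
  obtain ⟨m, hm⟩ : Int.gcd n a ∣ n := by exact_mod_cast Int.gcd_dvd_left (n : ℤ) a
  obtain ⟨b, hb⟩ : (Int.gcd n a : ℤ) ∣ a := Int.gcd_dvd_right _ _
  have hg : (Int.gcd n a : ℤ) ≠ 0 := by
    intro h
    have : Int.gcd n a = 0 := by exact_mod_cast h
    rw [this] at hm
    omega
  have hm0 : (m : ℤ) ≠ 0 := by
    rintro h
    have : m = 0 := by exact_mod_cast h
    rw [this] at hm
    omega
  have hmZ : (n : ℤ) = Int.gcd n a * m := by exact_mod_cast hm
  have hbez := Int.gcd_eq_gcd_ab n a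
  generalize Int.gcd n a = g at *
  let j : ZMod g →+ ZMod n := ZMod.lift g ⟨zmultiplesHom (ZMod n) (m : ZMod n), by
    simp only [zmultiplesHom_apply, natCast_zsmul, nsmul_eq_mul]
    rw [← Nat.cast_mul, ← hm, ZMod.natCast_self]⟩
  have hj : ∀ s : ℤ, j (s : ZMod g) = ((s * m : ℤ) : ZMod n) := fun s => by simp [j]
  refine ⟨j, (injective_iff_map_eq_zero _).2 fun s hs => ?_, fun t => ?_⟩
  · obtain ⟨s, rfl⟩ := ZMod.intCast_surjective s
    rw [hj, ZMod.intCast_zmod_eq_zero_iff_dvd, hmZ] at hs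
    exact (ZMod.intCast_zmod_eq_zero_iff_dvd _ _).2 (Int.dvd_of_mul_dvd_mul_right hm0 hs)
  · obtain ⟨t, rfl⟩ := ZMod.intCast_surjective t
    rw [zsmul_eq_mul, ← Int.cast_mul, ZMod.intCast_zmod_eq_zero_iff_dvd]
    constructor
    · intro h
      have hgt : g * (m : ℤ) ∣ g * t := by
        rw [← hmZ, hbez, add_mul, mul_assoc, mul_assoc, mul_left_comm a]
        exact dvd_add (dvd_mul_right _ _) (dvd_mul_of_dvd_right h _)
      obtain ⟨s, rfl⟩ := Int.dvd_of_mul_dvd_mul_left hg hgt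
      exact ⟨s, by rw [hj, mul_comm]⟩
    · rintro ⟨s, hs⟩
      obtain ⟨s, rfl⟩ := ZMod.intCast_surjective s
      rw [hj, ZMod.intCast_eq_intCast_iff_dvd_sub] at hs
      obtain ⟨u, hu⟩ := hs
      refine ⟨b * (s + g * u), ?_⟩
      have : t = s * m + n * u := by linarith
      rw [this, hb, hmZ]
      ring

section

variable {A B X : Type*} [AddCommGroup A] [AddCommGroup B] [AddCommGroup X]

/-- The cokernel of `a` on a free `ZMod n`-module. -/
theorem exists_surjective_ker_eq_range_zsmul {b n : ℕ} (e : A ≃+ (Fin b → ZMod n)) (a : ℤ) :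
    ∃ q : A →+ (Fin b → ZMod (Int.gcd n a)), Function.Surjective q ∧
      ∀ t, q t = 0 ↔ ∃ s, a • s = t := by
  obtain ⟨q, hq, hq'⟩ := ZMod.exists_surjective_ker_eq_range_zsmul n a
  refine ⟨(q.compLeft (Fin b)).comp e.toAddMonoidHom, hq.comp_left.comp e.surjective,
    fun t => ?_⟩
  trans ∀ i, ∃ s, a • s = e t i
  · rw [funext_iff]
    exact forall_congr' fun i => hq' _
  · rw [Classical.skolem]
    constructor
    · rintro ⟨f, hf⟩
      refine ⟨e.symm f, e.injective ?_⟩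
      rw [map_zsmul, e.apply_symm_apply]
      exact funext hf
    · rintro ⟨s, rfl⟩
      exact ⟨e s, fun i => by simp⟩

/-- The kernel of `a` on a free `ZMod n`-module. -/
theorem exists_injective_range_eq_ker_zsmul {c n : ℕ} (hn : 0 < n)
    (e : B ≃+ (Fin c → ZMod n)) (a : ℤ) :
    ∃ j : (Fin c → ZMod (Int.gcd n a)) →+ B, Function.Injective j ∧
      ∀ t, a • t = 0 ↔ ∃ s, j s = t := by
  obtain ⟨j, hj, hj'⟩ := ZMod.exists_injective_range_eq_ker_zsmul hn a
  refine ⟨e.symm.toAddMonoidHom.comp (j.compLeft (Fin c)), e.symm.injective.comp hj.comp_left,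
    fun t => ?_⟩
  trans ∀ i, ∃ s, j s = e t i
  · rw [← e.map_eq_zero_iff, map_zsmul, funext_iff]
    simp only [← hj']
    rfl
  · rw [Classical.skolem]
    constructor
    · rintro ⟨f, hf⟩
      exact ⟨f, (e.symm_apply_eq).2 (funext hf)⟩
    · rintro ⟨s, rfl⟩
      exact ⟨s, fun i => by simp⟩

/-- An extension of free `ZMod g`-modules killed by `g` is a free `ZMod g`-module. -/
theorem nonempty_addEquiv_of_extension {b c g : ℕ} (i : (Fin b → ZMod g) →+ X)
    (p : X →+ (Fin c → ZMod g)) (hi : Function.Injective i) (hp : Function.Surjective p)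
    (hip : Function.Exact i p) (hX : ∀ t : X, g • t = 0) :
    Nonempty (X ≃+ (Fin (b + c) → ZMod g)) := by
  let _ : Module (ZMod g) X := AddCommGroup.zmodModule hX
  obtain ⟨s, hs⟩ := Module.projective_lifting_property (p.toZModLinearMap g) LinearMap.id hp
  let e := (Function.Exact.splitSurjectiveEquiv (f := i.toZModLinearMap g)
    (g := p.toZModLinearMap g) hip hi ⟨s, hs⟩).1
  exact ⟨e.toAddEquiv.trans ((LinearEquiv.sumArrowLequivProdArrow _ _ (ZMod g) _).symm.trans
    (LinearEquiv.funCongrLeft (ZMod g) _ finSumFinEquiv.symm)).toAddEquiv⟩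

theorem nonempty_addEquiv_of_exact {b c g : ℕ} (a : ℤ) (f : A →+ X) (d : X →+ B)
    (hf : ∀ t, f t = 0 ↔ ∃ s, a • s = t) (hfd : Function.Exact f d)
    (hd : ∀ t, a • t = 0 ↔ ∃ s, d s = t) (hX : ∀ t : X, g • t = 0)
    (hA : ∃ q : A →+ (Fin b → ZMod g), Function.Surjective q ∧ ∀ t, q t = 0 ↔ ∃ s, a • s = t)
    (hB : ∃ j : (Fin c → ZMod g) →+ B, Function.Injective j ∧ ∀ t, a • t = 0 ↔ ∃ s, j s = t) :
    Nonempty (X ≃+ (Fin (b + c) → ZMod g)) := by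
  obtain ⟨q, hq, hqa⟩ := hA
  obtain ⟨j, hj, hja⟩ := hB
  have hker : q.ker ≤ f.ker := fun t ht => (hf t).2 ((hqa t).1 ht)
  let i : (Fin b → ZMod g) →+ X := q.liftOfSurjective hq ⟨f, hker⟩
  have hiq : ∀ t, i (q t) = f t := fun t => q.liftOfRightInverse_comp_apply _ _ ⟨f, hker⟩ t
  have hex : ∀ t, ∃ s, j s = d t := fun t => (hja _).1 ((hd _).2 ⟨t, rfl⟩)
  choose p hp using hex
  let p' : X →+ (Fin c → ZMod g) :=
    AddMonoidHom.mk' p fun u v => hj (by rw [map_add, hp, hp, hp, map_add])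
  refine nonempty_addEquiv_of_extension i p' ?_ ?_ ?_ hX
  · rw [injective_iff_map_eq_zero]
    intro t ht
    obtain ⟨t, rfl⟩ := hq t
    rw [hiq] at ht
    exact (hqa t).2 ((hf t).1 ht)
  · intro t
    obtain ⟨s, hs⟩ := (hd _).1 ((hja _).2 ⟨t, rfl⟩)
    exact ⟨s, hj ((hp s).trans hs)⟩
  · intro t
    have : p' t = 0 ↔ d t = 0 := by
      rw [← hp, map_eq_zero_iff j hj]; rfl
    rw [this, hfd t]
    constructor
    · rintro ⟨s, rfl⟩
      exact ⟨q s, hiq s⟩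
    · rintro ⟨s, rfl⟩
      obtain ⟨s, rfl⟩ := hq s
      exact ⟨s, (hiq s).symm⟩

end

section

open MonoidalCategory Pointwise

/-- The functor `M ↦ M ⊗ K` for a chain complex `K` of `R`-modules. -/
noncomputable def tensorComplex {R : Type} [CommRing R] (K : ChainComplex (ModuleCat.{0} R) ℕ) :
    ModuleCat.{0} R ⥤ ChainComplex (ModuleCat.{0} R) ℕ where
  obj M := (((tensoringLeft (ModuleCat.{0} R)).obj M).mapHomologicalComplex _).obj K
  map f := (NatTrans.mapHomologicalComplex ((tensoringLeft (ModuleCat.{0} R)).map f) _).app K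

instance {R : Type} [CommRing R] (K : ChainComplex (ModuleCat.{0} R) ℕ) :
    (tensorComplex K).PreservesZeroMorphisms where
  map_zero X Y := by
    ext i : 1
    exact (tensorRight (K.X i)).map_zero X Y

variable {R : Type} [CommRing R]

theorem tensorComplex_shortExact (K : ChainComplex (ModuleCat.{0} R) ℕ)
    (hK : ∀ i, Projective (K.X i)) {S : ShortComplex (ModuleCat.{0} R)} (hS : S.ShortExact) :
    (S.map (tensorComplex K)).ShortExact := by
  refine HomologicalComplex.shortExact_of_degreewise_shortExact _ fun i => ?_
  have : Module.Projective R (K.X i) := (IsProjective.iff_projective (K.X i)).2 (hK i)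
  exact hS.map_of_exact (tensorRight (K.X i))

/-- `Tor_k(M, N)`, computed from the chosen projective resolution of `N`. -/
noncomputable abbrev torHomology (N M : ModuleCat.{0} R) (k : ℕ) : ModuleCat.{0} R :=
  ((tensorComplex (projectiveResolution N).complex).obj M).homology k

/-- Scalars act on `Tor_k(M, N)` through either variable, hence through `ε`. -/
theorem homologyMap_tensorComplex_smul {N : ModuleCat.{0} R} (ε : R →+* ℤ)
    (hN : ∀ (a : R) (t : N), a • t = ε a • t) (M : ModuleCat.{0} R) (a : R) (k : ℕ) :
    HomologicalComplex.homologyMap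
      ((tensorComplex (projectiveResolution N).complex).map (a • 𝟙 M)) k =
      ε a • 𝟙 (torHomology N M k) := by
  let P := projectiveResolution N
  let F := (tensoringLeft (ModuleCat.{0} R)).obj M
  have hNa : a • 𝟙 N = ε a • 𝟙 N := by
    ext t
    simpa using hN a t
  have hcomm {X : ModuleCat.{0} R} (p : X ⟶ N) : (a • 𝟙 X) ≫ p = p ≫ (a • 𝟙 N) := by simp
  have h : Homotopy (a • 𝟙 P.complex) (ε a • 𝟙 P.complex) :=
    ProjectiveResolution.liftHomotopy (a • 𝟙 N) _ _
      (by
        ext1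
        exact hcomm (P.π.f 0))
      (by rw [hNa]; ext1; simp)
  have h1 : (tensorComplex P.complex).map (a • 𝟙 M) =
      (F.mapHomologicalComplex _).map (a • 𝟙 P.complex) := by
    ext i : 1
    change (a • 𝟙 M) ▷ P.complex.X i = M ◁ (a • 𝟙 (P.complex.X i))
    simp
  refine (congrArg (HomologicalComplex.homologyMap · k) h1).trans
    (((F.mapHomotopy h).homologyMap_eq k).trans ?_)
  have h2 : (F.mapHomologicalComplex _).map (ε a • 𝟙 P.complex) =
      ε a • 𝟙 ((F.mapHomologicalComplex _).obj P.complex) := by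
    rw [CategoryTheory.Functor.map_zsmul, CategoryTheory.Functor.map_id]
  refine (congrArg (HomologicalComplex.homologyMap · k) h2).trans ?_
  refine ((HomologicalComplex.homologyFunctor (ModuleCat.{0} R) _ k).map_zsmul).trans ?_
  exact congrArg (ε a • ·) (CategoryTheory.Functor.map_id _ _)

theorem zsmul_torHomology_eq_zero {N : ModuleCat.{0} R} (ε : R →+* ℤ)
    (hN : ∀ (a : R) (t : N), a • t = ε a • t) (M : ModuleCat.{0} R) (a : R)
    (ha : ∀ m : M, a • m = 0) (k : ℕ) (t : torHomology N M k) : ε a • t = 0 := by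
  have h0 : a • 𝟙 M = 0 := by
    ext m
    exact ha m
  have h := homologyMap_tensorComplex_smul ε hN M a k
  rw [h0, Functor.map_zero, HomologicalComplex.homologyMap_zero] at h
  have := congrArg (fun f => f.hom t) h
  simpa using this.symm

/-- The long exact sequence of `Tor` for `0 → M → M → M/aM → 0`. -/
theorem torHomology_exact {N : ModuleCat.{0} R} (ε : R →+* ℤ)
    (hN : ∀ (a : R) (t : N), a • t = ε a • t) (M : Type) [AddCommGroup M] [Module R M] (a : R)
    (ha : IsSMulRegular M a) :
    (∃ f : torHomology N (.of R M) 0 →+ torHomology N (.of R (QuotSMulTop a M)) 0,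
      Function.Surjective f ∧ ∀ t, f t = 0 ↔ ∃ s, ε a • s = t) ∧
    ∀ k, ∃ (f : torHomology N (.of R M) (k + 1) →+ torHomology N (.of R (QuotSMulTop a M)) (k + 1))
      (d : torHomology N (.of R (QuotSMulTop a M)) (k + 1) →+ torHomology N (.of R M) k),
      (∀ t, f t = 0 ↔ ∃ s, ε a • s = t) ∧ Function.Exact f d ∧
      ∀ t, ε a • t = 0 ↔ ∃ s, d s = t := by
  let P := (projectiveResolution N).complex
  let S : ShortComplex (ModuleCat.{0} R) :=
    ShortComplex.mk (a • 𝟙 (ModuleCat.of R M))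
      (ModuleCat.ofHom (Submodule.mkQ (a • (⊤ : Submodule R M)))) (by
        ext m
        exact (Submodule.Quotient.mk_eq_zero _).2
          (Submodule.smul_mem_pointwise_smul m a (⊤ : Submodule R M) trivial))
  have hS : S.ShortExact := by
    have : Mono S.f := (ModuleCat.mono_iff_injective _).2 ha
    have : Epi S.g := (ModuleCat.epi_iff_surjective _).2 (Submodule.mkQ_surjective _)
    refine ShortComplex.ShortExact.mk
      ((ShortComplex.ShortExact.moduleCat_exact_iff_function_exact S).2 ?_)
    intro m
    change Submodule.Quotient.mk m = 0 ↔ _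
    rw [Submodule.Quotient.mk_eq_zero, Submodule.mem_smul_pointwise_iff_exists]
    exact exists_congr fun s => and_iff_right trivial
  have hT := tensorComplex_shortExact P (fun i => inferInstance) hS
  have hmul (k : ℕ) (s : torHomology N (.of R M) k) :
      (HomologicalComplex.homologyMap (S.map (tensorComplex P)).f k).hom s = ε a • s := by
    have := congrArg (fun f => f.hom s) (homologyMap_tensorComplex_smul ε hN (.of R M) a k)
    exact this
  have h2 (k : ℕ) := (ShortComplex.ShortExact.moduleCat_exact_iff_function_exact _).1
    (hT.homology_exact₂ k)
  have h1 (k : ℕ) := (ShortComplex.ShortExact.moduleCat_exact_iff_function_exact _).1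
    (hT.homology_exact₁ (k + 1) k rfl)
  have h3 (k : ℕ) := (ShortComplex.ShortExact.moduleCat_exact_iff_function_exact _).1
    (hT.homology_exact₃ (k + 1) k rfl)
  have hf (k : ℕ) (t : torHomology N (.of R M) k) :
      (HomologicalComplex.homologyMap (S.map (tensorComplex P)).g k).hom t = 0 ↔
        ∃ s : torHomology N (.of R M) k, ε a • s = t := by
    refine (h2 k t).trans (exists_congr fun s => ?_)
    exact Eq.congr_left (hmul k s)
  refine ⟨⟨(HomologicalComplex.homologyMap (S.map (tensorComplex P)).g 0).hom.toAddMonoidHom,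
    ?_, hf 0⟩, fun k =>
    ⟨(HomologicalComplex.homologyMap (S.map (tensorComplex P)).g (k + 1)).hom.toAddMonoidHom,
      (hT.δ (k + 1) k rfl).hom.toAddMonoidHom, hf (k + 1), h3 k, fun t => ?_⟩⟩
  · have := hT.epi_g
    exact (ModuleCat.epi_iff_surjective _).1
      (HomologicalComplex.epi_homologyMap_of_epi_of_not_rel (S.map (tensorComplex P)).g 0 (by simp))
  · exact (Eq.congr_left (hmul k t)).symm.trans (h1 k t)

/-- `Tor` is the homology of the tensor product with the chosen resolution. -/
noncomputable def torIso (N M : ModuleCat.{0} R) (k : ℕ) :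
    ((Tor (ModuleCat.{0} R) k).obj M).obj N ≅ torHomology N M k :=
  (projectiveResolution N).isoLeftDerivedObj _ k

theorem torHomology_zero_unit (N : ModuleCat.{0} R) :
    Nonempty (torHomology N (.of R R) 0 ≅ N) :=
  ⟨(torIso N (.of R R) 0).symm ≪≫
    ((tensoringLeft (ModuleCat.{0} R)).obj (.of R R)).leftDerivedZeroIsoSelf.app N ≪≫ λ_ N⟩

theorem torHomology_succ_unit (N : ModuleCat.{0} R) (k : ℕ) :
    Subsingleton (torHomology N (.of R R) (k + 1)) := by
  let e : (tensorComplex (projectiveResolution N).complex).obj (.of R R) ≅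
      (projectiveResolution N).complex :=
    HomologicalComplex.Hom.isoOfComponents (fun i => λ_ _)
      (fun i j _ => (leftUnitor_naturality _).symm)
  apply ModuleCat.subsingleton_of_isZero
  refine Limits.IsZero.of_iso ?_ (HomologicalComplex.homologyMapIso e (k + 1))
  exact ((projectiveResolution N).complex_exactAt_succ k).isZero_homology

/-- `M` is killed by an element over `n`, and its `Tor` groups against `N` are direct sums of
binomially many copies of `ℤ/n`. -/
def HasBinomialTor (ε : R →+* ℤ) (N : ModuleCat.{0} R) (M : Type) [AddCommGroup M] [Module R M]
    (m n : ℕ) : Prop :=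
  (∃ z : R, ε z = n ∧ ∀ w : M, z • w = 0) ∧
    ∀ k, Nonempty (torHomology N (.of R M) k ≃+ (Fin (m.choose k) → ZMod n))

theorem HasBinomialTor.congr {ε : R →+* ℤ} {N : ModuleCat.{0} R} {M M' : Type} [AddCommGroup M]
    [Module R M] [AddCommGroup M'] [Module R M'] (e : M ≃ₗ[R] M') {m n : ℕ}
    (h : HasBinomialTor ε N M m n) : HasBinomialTor ε N M' m n := by
  obtain ⟨⟨z, hz, hzM⟩, h⟩ := h
  refine ⟨⟨z, hz, fun w => e.symm.injective (by simp [hzM])⟩, fun k => ?_⟩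
  exact (h k).map fun f => (((tensorComplex _ ⋙ HomologicalComplex.homologyFunctor _ _ k).mapIso
    e.toModuleIso).toLinearEquiv.toAddEquiv).symm.trans f

theorem smul_quotSMulTop_eq_zero (M : Type) [AddCommGroup M] [Module R M] (a : R)
    (w : QuotSMulTop a M) : a • w = 0 := by
  obtain ⟨w, rfl⟩ := Submodule.Quotient.mk_surjective _ w
  exact (Submodule.Quotient.mk_eq_zero _).2
    (Submodule.smul_mem_pointwise_smul w a (⊤ : Submodule R M) trivial)

theorem HasBinomialTor.quotSMulTop {ε : R →+* ℤ} {N : ModuleCat.{0} R}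
    (hN : ∀ (a : R) (t : N), a • t = ε a • t) {M : Type} [AddCommGroup M] [Module R M]
    {m n : ℕ} (hn : 0 < n) (h : HasBinomialTor ε N M m n) {a : R} (ha : IsSMulRegular M a) :
    HasBinomialTor ε N (QuotSMulTop a M) (m + 1) (Int.gcd n (ε a)) := by
  obtain ⟨⟨z, hz, hzM⟩, h⟩ := h
  have hz' : ∃ z : R, ε z = (Int.gcd n (ε a) : ℕ) ∧ ∀ w : QuotSMulTop a M, z • w = 0 := by
    refine ⟨z * Int.gcdA n (ε a) + a * Int.gcdB n (ε a), ?_, fun w => ?_⟩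
    · simp [Int.gcd_eq_gcd_ab, hz]
    · have hzw : z • w = 0 := by
        obtain ⟨w, rfl⟩ := Submodule.Quotient.mk_surjective _ w
        rw [← Submodule.Quotient.mk_smul, hzM, Submodule.Quotient.mk_zero]
      rw [add_smul, mul_comm z, mul_comm a, mul_smul, mul_smul, hzw,
        smul_quotSMulTop_eq_zero, smul_zero, smul_zero, add_zero]
  refine ⟨hz', fun k => ?_⟩
  obtain ⟨z', hz', hzQ⟩ := hz'
  have hX (k : ℕ) (t : torHomology N (.of R (QuotSMulTop a M)) k) :
      Int.gcd n (ε a) • t = 0 := by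
    rw [← natCast_zsmul, ← hz']
    exact zsmul_torHomology_eq_zero ε hN _ z' hzQ k t
  obtain ⟨⟨f, hf, hfa⟩, hk⟩ := torHomology_exact ε hN M a ha
  cases k with
  | zero =>
    have hA := (h 0).elim fun e => exists_surjective_ker_eq_range_zsmul e (ε a)
    have := nonempty_addEquiv_of_exact (B := PUnit.{1}) (c := 0) (ε a) f 0 hfa
      (fun t => by simpa using hf t) (fun t => by simp) (hX 0) hA
      ⟨0, fun _ _ _ => Subsingleton.elim _ _, fun t => by simp⟩
    rwa [add_zero, Nat.choose_zero_right, ← Nat.choose_zero_right (m + 1)] at this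
  | succ k =>
    obtain ⟨f, d, hf, hfd, hd⟩ := hk k
    have hA := (h (k + 1)).elim fun e => exists_surjective_ker_eq_range_zsmul e (ε a)
    have hB := (h k).elim fun e => exists_injective_range_eq_ker_zsmul hn e (ε a)
    rw [Nat.choose_succ_succ, add_comm (m.choose k)]
    exact nonempty_addEquiv_of_exact (ε a) f d hf hfd hd (hX _) hA hB

theorem hasBinomialTor_quotSMulTop_self {ε : R →+* ℤ} {N : ModuleCat.{0} R}
    (hN : ∀ (a : R) (t : N), a • t = ε a • t) (e : N ≃+ ℤ) {a : R} (ha : IsSMulRegular R a)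
    (hε : 0 < ε a) : HasBinomialTor ε N (QuotSMulTop a R) 0 (ε a).natAbs := by
  have hg : Int.gcd (0 : ℕ) (ε a) = (ε a).natAbs := by simp
  have habs : ε a = (ε a).natAbs := (Int.natAbs_of_nonneg hε.le).symm
  refine ⟨⟨a, habs, smul_quotSMulTop_eq_zero R a⟩, fun k => ?_⟩
  have hX (k : ℕ) (t : torHomology N (.of R (QuotSMulTop a R)) k) : (ε a).natAbs • t = 0 := by
    rw [← natCast_zsmul, ← habs]
    exact zsmul_torHomology_eq_zero ε hN _ a (smul_quotSMulTop_eq_zero R a) k t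
  obtain ⟨⟨f, hf, hfa⟩, hk⟩ := torHomology_exact ε hN R a ha
  obtain ⟨e₀⟩ := torHomology_zero_unit N
  let e₁ : torHomology N (.of R R) 0 ≃+ ℤ := e₀.toLinearEquiv.toAddEquiv.trans e
  cases k with
  | zero =>
    let e₂ : torHomology N (.of R R) 0 ≃+ (Fin 1 → ZMod 0) :=
      e₁.trans (LinearEquiv.funUnique (Fin 1) ℤ ℤ).symm.toAddEquiv
    have hA := exists_surjective_ker_eq_range_zsmul e₂ (ε a)
    rw [hg] at hA
    exact nonempty_addEquiv_of_exact (B := PUnit.{1}) (c := 0) (ε a) f 0 hfa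
      (fun t => by simpa using hf t) (fun t => by simp) (hX 0) hA
      ⟨0, fun _ _ _ => Subsingleton.elim _ _, fun t => by simp⟩
  | succ k =>
    obtain ⟨f, d, hf, hfd, hd⟩ := hk k
    have := torHomology_succ_unit N k
    have hinj (t : torHomology N (.of R R) k) (ht : ε a • t = 0) : t = 0 := by
      cases k with
      | zero =>
        refine e₁.injective ?_
        have := congrArg e₁ ht
        rw [map_zsmul, map_zero, smul_eq_mul] at this
        rw [map_zero]
        exact (mul_eq_zero.1 this).resolve_left hε.ne'
      | succ k =>
        have := torHomology_succ_unit N k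
        exact Subsingleton.elim _ _
    exact nonempty_addEquiv_of_exact (b := 0) (c := 0) (ε a) f d hf hfd hd (hX _)
      ⟨0, fun _ => ⟨0, Subsingleton.elim _ _⟩,
        fun t => iff_of_true rfl ⟨0, Subsingleton.elim _ _⟩⟩
      ⟨0, fun _ _ _ => Subsingleton.elim _ _, fun t =>
        ⟨fun h => ⟨0, (hinj t h).symm⟩, by rintro ⟨s, rfl⟩; exact smul_zero _⟩⟩

theorem HasBinomialTor.quot_ofList {ε : R →+* ℤ} {N : ModuleCat.{0} R}
    (hN : ∀ (a : R) (t : N), a • t = ε a • t) (rs : List R) {M : Type} [AddCommGroup M]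
    [Module R M] {m n : ℕ} (hn : 0 < n) (h : HasBinomialTor ε N M m n)
    (hrs : RingTheory.Sequence.IsWeaklyRegular M rs) {x : ℕ}
    (hx : ∀ d : ℕ, d ∣ x ↔ d ∣ n ∧ ∀ a ∈ rs, (d : ℤ) ∣ ε a) :
    HasBinomialTor ε N (M ⧸ (Ideal.ofList rs • ⊤ : Submodule R M)) (m + rs.length) x := by
  induction rs generalizing M m n with
  | nil =>
    obtain rfl : x = n := Nat.dvd_left_iff_eq.1 fun d => by simpa using hx d
    exact h.congr (Submodule.quotEquivOfEqBot _ (by simp)).symm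
  | cons a rs ih =>
    obtain ⟨ha, hrs⟩ := (RingTheory.Sequence.isWeaklyRegular_cons_iff M a rs).1 hrs
    have := ih (Int.gcd_pos_of_ne_zero_left _ (by exact_mod_cast hn.ne'))
      (h.quotSMulTop hN hn ha) hrs fun d => by
        rw [hx, ← Int.natCast_dvd_natCast (n := Int.gcd _ _), Int.dvd_coe_gcd_iff]
        simp [and_assoc, Int.natCast_dvd_natCast]
    rw [List.length_cons, add_comm rs.length, ← add_assoc]
    exact this.congr (Submodule.quotOfListConsSMulTopEquivQuotSMulTopInner M a rs).symm

end

/-- if `y 0, …, y (r-1)` is a regular sequence in a commutative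
ring `R` generating a proper ideal `I`, `ε : R →+* ℤ` is a ring homomorphism
with `ε (y i) > 0` for all `i`, and `x = gcd (ε (y 0), …, ε (y (r-1)))`, then
`Tor_k^R(R/I, ℤ)` (with `ℤ` an `R`-module via `ε`) is a direct sum of
`(r-1).choose k` copies of `ℤ/xℤ` for `0 ≤ k ≤ r - 1`, and vanishes for
`k ≥ r`. -/
theorem tor_quotient_regular_sequence (R : Type) [CommRing R]
    (r : ℕ) (hr : 1 ≤ r) (y : Fin r → R)
    (hreg : RingTheory.Sequence.IsWeaklyRegular R (List.ofFn y))
    (I : Ideal R) (hI : I = Ideal.span (Set.range y)) (hIproper : I ≠ ⊤)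
    (ε : R →+* ℤ) (hpos : ∀ i, 0 < ε (y i)) (x : ℕ)
    (hx : (x : ℤ) = Finset.univ.gcd (fun i => ε (y i))) :
    letI : Module R ℤ := Module.compHom ℤ ε
    (∀ k : ℕ, k ≤ r - 1 →
      Nonempty ((((Tor (ModuleCat R) k).obj
          (ModuleCat.of R (R ⧸ I))).obj (ModuleCat.of R ℤ)) ≃+
        (Fin ((r - 1).choose k) → ZMod x))) ∧
    (∀ k : ℕ, r ≤ k →
      Subsingleton ((((Tor (ModuleCat R) k).obj
          (ModuleCat.of R (R ⧸ I))).obj (ModuleCat.of R ℤ)))) := by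
  let _ : Module R ℤ := Module.compHom ℤ ε
  let N : ModuleCat.{0} R := ModuleCat.of R ℤ
  have hN (a : R) (t : N) : a • t = ε a • t := rfl
  obtain ⟨r, rfl⟩ := Nat.exists_eq_add_of_le' hr
  rw [List.ofFn_succ] at hreg
  obtain ⟨hy, hys⟩ := (RingTheory.Sequence.isWeaklyRegular_cons_iff R _ _).1 hreg
  have hQ := (hasBinomialTor_quotSMulTop_self hN (AddEquiv.refl ℤ) hy (hpos 0)).quot_ofList hN _
    (Int.natAbs_pos.2 (hpos 0).ne') hys (x := x) fun d => by
      rw [← Int.natCast_dvd_natCast, hx, Finset.dvd_gcd_iff, ← Int.natCast_dvd]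
      simp [Fin.forall_fin_succ, List.mem_ofFn]
  have hI' : Ideal.ofList (y 0 :: List.ofFn fun i : Fin r => y i.succ) • (⊤ : Submodule R R) =
      I := by
    rw [← List.ofFn_succ, hI, smul_eq_mul, Ideal.mul_top]
    exact congrArg Ideal.span (Set.ext fun a => List.mem_ofFn)
  have hT := hQ.congr
    ((Submodule.quotOfListConsSMulTopEquivQuotSMulTopInner R _ _).symm.trans
      (Submodule.quotEquivOfEq _ _ hI'))
  rw [zero_add, List.length_ofFn] at hT
  have key (k : ℕ) : Nonempty ((((Tor (ModuleCat R) k).obj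
      (ModuleCat.of R (R ⧸ I))).obj N) ≃+ (Fin (r.choose k) → ZMod x)) :=
    (hT.2 k).map fun e => (torIso N _ k).toLinearEquiv.toAddEquiv.trans e
  refine ⟨fun k _ => key k, fun k hk => ?_⟩
  obtain ⟨e⟩ := key k
  rw [Nat.choose_eq_zero_of_lt hk] at e
  exact e.toEquiv.subsingleton
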